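/- The group presented by ⟨a, b | a⁵ = 1, b² = 1, (ab)³ = 1⟩ has order 60 and is isomorphic to the alternating group A₅ (equivalently, the proper icosahedral rotation group I_p). -/

import Mathlib

/-- The relations of the standard presentation `⟨a, b | a⁵, b², (ab)³⟩`. -/
def icoRels : Set (FreeGroup (Fin 2)) :=
  {(FreeGroup.of 0) ^ 5, (FreeGroup.of 1) ^ 2, (FreeGroup.of 0 * FreeGroup.of 1) ^ 3}

namespace IcoAux

theorem mem_all {G : Type*} [Group G] (a b : G) (ha : a ^ 5 = 1) (hb : b * b = 1)
    (h1 : b * a * b = a ^ 4 * b * a ^ 4) (g : G) (hg : g ∈ Subgroup.closure ({a, b} : Set G)) :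
    ∃ i j : Fin 5, g = a ^ i.1 ∨ g = a ^ i.1 * b * a ^ j.1 ∨
      g = a ^ i.1 * b * a ^ 2 * b * a ^ j.1 ∨ g = a ^ i.1 * b * a ^ 2 * b * a ^ 3 * b := by
  have red : ∀ n : ℕ, a ^ n = a ^ (n % 5) := fun n => pow_eq_pow_mod n ha
  have key : ∀ g : G, (∃ i j : ℕ, g = a ^ i ∨ g = a ^ i * b * a ^ j ∨
      g = a ^ i * b * a ^ 2 * b * a ^ j ∨ g = a ^ i * b * a ^ 2 * b * a ^ 3 * b) →
      ∃ i j : Fin 5, g = a ^ i.1 ∨ g = a ^ i.1 * b * a ^ j.1 ∨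
      g = a ^ i.1 * b * a ^ 2 * b * a ^ j.1 ∨ g = a ^ i.1 * b * a ^ 2 * b * a ^ 3 * b := by
    rintro g ⟨i, j, h⟩
    refine ⟨⟨i % 5, Nat.mod_lt _ (by norm_num)⟩, ⟨j % 5, Nat.mod_lt _ (by norm_num)⟩, ?_⟩
    simpa only [← red] using h
  have hbb : ∀ x : G, b * (b * x) = x := fun x => by rw [← mul_assoc, hb, one_mul]
  have haa : ∀ (m n : ℕ) (x : G), a ^ m * (a ^ n * x) = a ^ (m + n) * x := fun m n x => by
    rw [← mul_assoc, pow_add]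
  have ha5 : ∀ n : ℕ, a ^ (n + 5) = a ^ n := fun n => by rw [pow_add, ha, mul_one]
  -- b a b
  have e1 : ∀ x : G, b * (a ^ 1 * (b * x)) = a ^ 4 * (b * (a ^ 4 * x)) := fun x => by
    rw [pow_one]; simpa only [mul_assoc] using congrArg (· * x) h1
  have e4 : ∀ x : G, b * (a ^ 4 * (b * x)) = a ^ 1 * (b * (a ^ 1 * x)) := fun x => by
    have h := e1 (a ^ 1 * (b * (a ^ 4 * (b * x))))
    have := e1 (b * (a ^ 1 * x))
    rw [hbb] at this
    calc b * (a ^ 4 * (b * x)) = a ^ 1 * (a ^ 4 * (b * (a ^ 4 * (b * (a ^ 1 * (a ^ 4 * x)))))) := by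
          simp only [haa, Nat.reduceAdd, ha, one_mul]
      _ = a ^ 1 * (b * (a ^ 1 * x)) := by
          have h2 := e1 (b * (a ^ 1 * (a ^ 4 * x)))
          rw [hbb] at h2
          rw [← h2]; simp only [haa, Nat.reduceAdd, ha5 1]
  have e3 : ∀ x : G, b * (a ^ 3 * (b * x)) = a ^ 1 * (b * (a ^ 2 * (b * (a ^ 1 * x)))) := fun x => by
    have : b * (a ^ 3 * (b * x)) = b * (a ^ 4 * (b * (b * (a ^ 4 * (b * x))))) := by
      rw [hbb, haa]; simp only [Nat.reduceAdd, ha5 3]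
    rw [this, e4, e4, haa]
  -- z a = a^4 z
  have ez : ∀ x : G, b * (a ^ 2 * (b * (a ^ 3 * (b * (a ^ 1 * x))))) =
      a ^ 4 * (b * (a ^ 2 * (b * (a ^ 3 * (b * x))))) := fun x => by
    have h2 : b * (a ^ 2 * (b * (a ^ 3 * (b * x)))) =
        a ^ 1 * (b * (a ^ 2 * (b * (a ^ 3 * (b * (a ^ 1 * x)))))) := by
      rw [e3 x, haa, e3, haa]
    rw [h2, haa]; simp only [Nat.reduceAdd, ha, one_mul]
  have e22 : ∀ x : G, b * (a ^ 2 * (b * (a ^ 2 * (b * x)))) =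
      a ^ 4 * (b * (a ^ 2 * (b * (a ^ 4 * x)))) := fun x => by
    have h2 : b * (a ^ 2 * (b * x)) = a ^ 4 * (b * (a ^ 3 * (b * (a ^ 4 * x)))) := by
      rw [e3]; simp only [haa, Nat.reduceAdd, ha, one_mul]
    rw [h2, haa]
    simp only [Nat.reduceAdd, ha5 1]
    rw [e1, haa]; simp only [Nat.reduceAdd, ha5 2]
  have stepa : ∀ g : G, (∃ i j : Fin 5, g = a ^ i.1 ∨ g = a ^ i.1 * b * a ^ j.1 ∨
      g = a ^ i.1 * b * a ^ 2 * b * a ^ j.1 ∨ g = a ^ i.1 * b * a ^ 2 * b * a ^ 3 * b) →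
      ∃ i j : Fin 5, g * a = a ^ i.1 ∨ g * a = a ^ i.1 * b * a ^ j.1 ∨
      g * a = a ^ i.1 * b * a ^ 2 * b * a ^ j.1 ∨ g * a = a ^ i.1 * b * a ^ 2 * b * a ^ 3 * b := by
    rintro g ⟨i, j, h⟩
    apply key
    rcases h with rfl | rfl | rfl | rfl
    · exact ⟨i + 1, 0, Or.inl (by rw [pow_succ])⟩
    · exact ⟨i, j + 1, Or.inr (Or.inl (by rw [pow_succ _ j.1]; simp only [mul_assoc]))⟩
    · exact ⟨i, j + 1, Or.inr (Or.inr (Or.inl (by rw [pow_succ _ j.1]; simp only [mul_assoc])))⟩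
    · refine ⟨i + 4, 0, Or.inr (Or.inr (Or.inr ?_))⟩
      have := ez 1
      simp only [mul_one, pow_one] at this
      simp only [mul_assoc, pow_add, this]
  have stepb : ∀ g : G, (∃ i j : Fin 5, g = a ^ i.1 ∨ g = a ^ i.1 * b * a ^ j.1 ∨
      g = a ^ i.1 * b * a ^ 2 * b * a ^ j.1 ∨ g = a ^ i.1 * b * a ^ 2 * b * a ^ 3 * b) →
      ∃ i j : Fin 5, g * b = a ^ i.1 ∨ g * b = a ^ i.1 * b * a ^ j.1 ∨
      g * b = a ^ i.1 * b * a ^ 2 * b * a ^ j.1 ∨ g * b = a ^ i.1 * b * a ^ 2 * b * a ^ 3 * b := by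
    rintro g ⟨i, j, h⟩
    apply key
    have f1 := e1 1
    have f3 := e3 1
    have f4 := e4 1
    have f22 := e22 1
    simp only [mul_one] at f1 f3 f4 f22
    rcases h with rfl | rfl | rfl | rfl
    · exact ⟨i, 0, Or.inr (Or.inl (by simp))⟩
    · have hj : j.1 = 0 ∨ j.1 = 1 ∨ j.1 = 2 ∨ j.1 = 3 ∨ j.1 = 4 := by omega
      rcases hj with h | h | h | h | h <;> rw [h]
      · exact ⟨i, 0, Or.inl (by simp [mul_assoc, hb])⟩
      · exact ⟨i + 4, 4, Or.inr (Or.inl (by simp only [mul_assoc, f1, haa]))⟩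
      · exact ⟨i, 0, Or.inr (Or.inr (Or.inl (by simp)))⟩
      · exact ⟨i + 1, 1, Or.inr (Or.inr (Or.inl (by simp only [mul_assoc, f3, haa])))⟩
      · exact ⟨i + 1, 1, Or.inr (Or.inl (by simp only [mul_assoc, f4, haa]))⟩
    · have hj : j.1 = 0 ∨ j.1 = 1 ∨ j.1 = 2 ∨ j.1 = 3 ∨ j.1 = 4 := by omega
      rcases hj with h | h | h | h | h <;> rw [h]
      · exact ⟨i, 2, Or.inr (Or.inl (by simp [mul_assoc, hb]))⟩
      · refine ⟨i + 4, 3, Or.inr (Or.inl ?_)⟩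
        simp only [mul_assoc, f1, haa, Nat.reduceAdd, ha5 1, e1, ← pow_add, ha5 3]
      · exact ⟨i + 4, 4, Or.inr (Or.inr (Or.inl (by simp only [mul_assoc, f22, haa])))⟩
      · exact ⟨i, 0, Or.inr (Or.inr (Or.inr rfl))⟩
      · refine ⟨i + 1, 2, Or.inr (Or.inr (Or.inl ?_))⟩
        simp only [mul_assoc, f4, haa, Nat.reduceAdd, e3, ← pow_add]
    · exact ⟨i, 3, Or.inr (Or.inr (Or.inl (by simp only [mul_assoc, hb, mul_one])))⟩
  have hai : a⁻¹ = a * a * a * a := by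
    rw [inv_eq_iff_mul_eq_one, ← ha]; simp only [pow_succ, pow_zero, one_mul, mul_assoc]
  have hbi : b⁻¹ = b := inv_eq_of_mul_eq_one_left hb
  induction hg using Subgroup.closure_induction_right with
  | one => exact ⟨0, 0, Or.inl (by simp)⟩
  | mul_right x hx y hy ih =>
    rcases hy with rfl | rfl
    · exact stepa _ ih
    · exact stepb _ ih
  | mul_inv_cancel x hx y hy ih =>
    rcases hy with rfl | rfl
    · rw [hai]; simp only [← mul_assoc]; exact stepa _ (stepa _ (stepa _ (stepa _ ih)))
    · rw [hbi]; exact stepb _ ih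

theorem card_le {G : Type*} [Group G] (a b : G) (ha : a ^ 5 = 1) (hb : b * b = 1)
    (h1 : b * a * b = a ^ 4 * b * a ^ 4) (h : Subgroup.closure ({a, b} : Set G) = ⊤) :
    Finite G ∧ Nat.card G ≤ 60 := by
  let f : Fin 5 × (Unit ⊕ Fin 5 ⊕ Fin 5 ⊕ Unit) → G := fun p =>
    match p with
    | (i, Sum.inl _) => a ^ i.1
    | (i, Sum.inr (Sum.inl j)) => a ^ i.1 * b * a ^ j.1
    | (i, Sum.inr (Sum.inr (Sum.inl j))) => a ^ i.1 * b * a ^ 2 * b * a ^ j.1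
    | (i, Sum.inr (Sum.inr (Sum.inr _))) => a ^ i.1 * b * a ^ 2 * b * a ^ 3 * b
  have hf : Function.Surjective f := by
    intro g
    obtain ⟨i, j, hh⟩ := mem_all a b ha hb h1 g (h ▸ Subgroup.mem_top g)
    rcases hh with rfl | rfl | rfl | rfl
    · exact ⟨(i, Sum.inl ()), rfl⟩
    · exact ⟨(i, Sum.inr (Sum.inl j)), rfl⟩
    · exact ⟨(i, Sum.inr (Sum.inr (Sum.inl j))), rfl⟩
    · exact ⟨(i, Sum.inr (Sum.inr (Sum.inr ()))), rfl⟩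
  refine ⟨Finite.of_surjective f hf, ?_⟩
  have := Nat.card_le_card_of_surjective f hf
  simpa using this

def A : alternatingGroup (Fin 5) := ⟨c[0, 1, 2, 3, 4], by rw [Equiv.Perm.mem_alternatingGroup]; decide +kernel⟩
def B : alternatingGroup (Fin 5) := ⟨c[0, 1] * c[2, 3], by rw [Equiv.Perm.mem_alternatingGroup]; decide +kernel⟩

theorem gen : ∀ x : alternatingGroup (Fin 5), ∃ i j : Fin 5, x = A ^ i.1 ∨ x = A ^ i.1 * B * A ^ j.1 ∨
      x = A ^ i.1 * B * A ^ 2 * B * A ^ j.1 ∨ x = A ^ i.1 * B * A ^ 2 * B * A ^ 3 * B := by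
  decide +kernel

end IcoAux

theorem presented_group_is_A5 :
    Nat.card (PresentedGroup icoRels) = 60 ∧
    Nonempty (PresentedGroup icoRels ≃* alternatingGroup (Fin 5)) := by
  let a : PresentedGroup icoRels := PresentedGroup.of 0
  let b : PresentedGroup icoRels := PresentedGroup.of 1
  have ha : a ^ 5 = 1 := PresentedGroup.one_of_mem (rels := icoRels) (Or.inl rfl)
  have hb : b ^ 2 = 1 := PresentedGroup.one_of_mem (rels := icoRels) (Or.inr (Or.inl rfl))
  have hab : (a * b) ^ 3 = 1 := PresentedGroup.one_of_mem (rels := icoRels) (Or.inr (Or.inr rfl))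
  have hb' : b * b = 1 := by rw [← pow_two, hb]
  have hai : a⁻¹ = a ^ 4 := by rw [inv_eq_iff_mul_eq_one, ← pow_succ', ha]
  have hbi : b⁻¹ = b := inv_eq_of_mul_eq_one_left hb'
  have h1 : b * a * b = a ^ 4 * b * a ^ 4 := by
    have h2 : b * a * b = a⁻¹ * (a * b) ^ 3 * b⁻¹ * a⁻¹ := by
      simp only [pow_succ, pow_zero, one_mul]; group
    rw [h2, hab, hai, hbi, mul_one]
  have hcl : Subgroup.closure ({a, b} : Set (PresentedGroup icoRels)) = ⊤ := by
    rw [← PresentedGroup.closure_range_of]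
    congr 1
    ext x
    simp [Fin.exists_fin_two, a, b, eq_comm]
  obtain ⟨hfin, hle⟩ := IcoAux.card_le a b ha hb' h1 hcl
  have hrel : ∀ r ∈ icoRels, FreeGroup.lift ![IcoAux.A, IcoAux.B] r = 1 := by
    rintro r (rfl | rfl | rfl) <;>
    simp only [map_pow, map_mul, FreeGroup.lift_apply_of, Matrix.cons_val_zero, Matrix.cons_val_one] <;>
    decide +kernel
  let φ := PresentedGroup.toGroup hrel
  have hφa : φ a = IcoAux.A := PresentedGroup.toGroup.of hrel
  have hφb : φ b = IcoAux.B := PresentedGroup.toGroup.of hrel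
  have hsurj : Function.Surjective φ := by
    intro x
    obtain ⟨i, j, h | h | h | h⟩ := IcoAux.gen x <;> rw [h, ← hφa]
    · exact ⟨a ^ i.1, by simp⟩
    · exact ⟨a ^ i.1 * b * a ^ j.1, by simp [hφb]⟩
    · exact ⟨a ^ i.1 * b * a ^ 2 * b * a ^ j.1, by simp [hφb]⟩
    · exact ⟨a ^ i.1 * b * a ^ 2 * b * a ^ 3 * b, by simp [hφb]⟩
  have hA : Nat.card (alternatingGroup (Fin 5)) = 60 := by
    rw [nat_card_alternatingGroup]; simp [Nat.factorial]
  have hge := Nat.card_le_card_of_surjective φ hsurj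
  rw [hA] at hge
  have hc : Nat.card (PresentedGroup icoRels) = 60 := le_antisymm hle hge
  refine ⟨hc, ⟨MulEquiv.ofBijective φ ?_⟩⟩
  exact (Nat.bijective_iff_surjective_and_card φ).2 ⟨hsurj, hc.trans hA.symm⟩
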